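/- Let C be a based complex of R-modules with a Morse matching M, let t = d − d̃ and let h̃ be the associated degree-1 map. Then for x ∈ C_α with α ∈ I_n, the perturbed homotopy from the perturbation lemma is given in closed form by h(x) = Σ_{i≥0} (h̃t)^i h̃(x) = Σ_{β ∈ I_{n+1}} Γ_{β,α}(x). -/

import Mathlib

noncomputable section
attribute [local instance] Classical.propDecidable

open DirectSum

universe u v w

/-- Directed paths in a digraph on `ι` with edge relation `E`. -/
inductive MPath {ι : Type v} (E : ι → ι → Prop) : ι → ι → Type v
  | nil (α : ι) : MPath E α α
  | cons {α β γ : ι} : E α β → MPath E β γ → MPath E α γ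

section Morse

variable (R : Type u) [Ring R] (ι : Type v) [DecidableEq ι]
  (V : ι → Type w) [∀ α, AddCommGroup (V α)] [∀ α, Module R (V α)]

/-- The linear endomorphism of `⨁ α, V α` with components `D α β : V α →ₗ[R] V β`
(by convention `0` on summands whose family of components has infinite support). -/
def toLin (D : ∀ α β, V α →ₗ[R] V β) : (⨁ α, V α) →ₗ[R] ⨁ α, V α :=
  DirectSum.toModule R ι _ fun α =>
    if h : {β | D α β ≠ 0}.Finite then
      ∑ β ∈ h.toFinset, (DirectSum.lof R ι V β).comp (D α β)
    else 0

/-- `(deg, V, D)` is a based complex: the components `D α β : C_α → C_β` of the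
differential lower degree by one, each column is finite, and the total
differential squares to zero. -/
structure IsBasedComplex (deg : ι → ℤ) (D : ∀ α β, V α →ₗ[R] V β) : Prop where
  deg_cond : ∀ α β, deg β ≠ deg α - 1 → D α β = 0
  fin : ∀ α, {β | D α β ≠ 0}.Finite
  dsq : toLin R ι V D ∘ₗ toLin R ι V D = 0

/-- Edges of the Morse graph `G^M(C)`: edges of `G(C)` not in `M` together with
the reversals of the edges in `M`. -/
def MorseEdge (D : ∀ α β, V α →ₗ[R] V β) (M : Set (ι × ι)) (α β : ι) : Prop :=
  (D α β ≠ 0 ∧ (α, β) ∉ M) ∨ (β, α) ∈ M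

/-- `M` is a Morse matching on the based complex `(deg, V, D)`. -/
structure IsMorseMatching (deg : ι → ℤ) (D : ∀ α β, V α →ₗ[R] V β)
    (M : Set (ι × ι)) : Prop where
  edge : ∀ e ∈ M, D e.1 e.2 ≠ 0
  iso : ∀ e ∈ M, Function.Bijective (D e.1 e.2)
  matching : ∀ e ∈ M, ∀ e' ∈ M,
    e.1 = e'.1 ∨ e.1 = e'.2 ∨ e.2 = e'.1 ∨ e.2 = e'.2 → e = e'
  wf : ∃ r : ι → ι → Prop, WellFounded r ∧ (∀ a b c, r a b → r b c → r a c) ∧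
    ∀ α β γ, deg γ = deg α →
      MorseEdge R ι V D M α β → MorseEdge R ι V D M β γ → r γ α

end Morse

/-- The set `M⁰` of vertices not incident to any edge of `M`. -/
def MZero {ι : Type v} (M : Set (ι × ι)) : Set ι := {α | ∀ β, (α, β) ∉ M ∧ (β, α) ∉ M}

section Morse2

variable (R : Type u) [Ring R] (ι : Type v) [DecidableEq ι]
  (V : ι → Type w) [∀ α, AddCommGroup (V α)] [∀ α, Module R (V α)]

/-- The differential `d̃` of `C̃`, keeping only the components of edges in `M`. -/
def dTilde (D : ∀ α β, V α →ₗ[R] V β) (M : Set (ι × ι)) :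
    (⨁ α, V α) →ₗ[R] ⨁ α, V α :=
  toLin R ι V fun α β => if (α, β) ∈ M then D α β else 0

/-- The degree one map `h̃`, sending `x ∈ C_α` to `-d⁻¹_{α,β} x` when `β → α ∈ M`. -/
def hTilde (D : ∀ α β, V α →ₗ[R] V β) (M : Set (ι × ι)) :
    (⨁ α, V α) →ₗ[R] ⨁ α, V α :=
  DirectSum.toModule R ι _ fun α =>
    if h : ∃ β, (β, α) ∈ M ∧ Function.Bijective (D β α) then
      -((DirectSum.lof R ι V h.choose).comp
        (LinearEquiv.ofBijective (D h.choose α) h.choose_spec.2).symm.toLinearMap)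
    else 0

/-- The projection `f̃ : C̃ → C̃^M`. -/
def fTilde (M : Set (ι × ι)) : (⨁ α, V α) →ₗ[R] ⨁ s : MZero M, V s.1 :=
  DirectSum.toModule R ι _ fun α =>
    if h : α ∈ MZero M then
      DirectSum.lof R (MZero M) (fun s => V s.1) ⟨α, h⟩
    else 0

/-- The inclusion `g̃ : C̃^M → C̃`. -/
def gTilde (M : Set (ι × ι)) : (⨁ s : MZero M, V s.1) →ₗ[R] ⨁ α, V α :=
  DirectSum.toModule R (MZero M) _ fun s => DirectSum.lof R ι V s.1

/-- The map attached to an edge `σ → τ` of the Morse graph: `-d⁻¹_{σ,τ}` if it is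
the reversal of an edge of `M`, and the component `d_{τ,σ}` otherwise. -/
def edgeMap (D : ∀ α β, V α →ₗ[R] V β) (M : Set (ι × ι)) (σ τ : ι) :
    V σ →ₗ[R] V τ :=
  if h : (τ, σ) ∈ M ∧ Function.Bijective (D τ σ) then
    -(LinearEquiv.ofBijective (D τ σ) h.2).symm.toLinearMap
  else D σ τ

/-- The map `C_α → C_β` attached to a directed path in the Morse graph. -/
def pathMap (D : ∀ α β, V α →ₗ[R] V β) (M : Set (ι × ι)) :
    {α β : ι} → MPath (MorseEdge R ι V D M) α β → (V α →ₗ[R] V β)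
  | _, _, .nil _ => LinearMap.id
  | _, _, .cons _e p => (pathMap D M p).comp (edgeMap R ι V D M _ _)

/-- `Γ_{β,α} : C_α → C_β`, the sum over all directed paths from `α` to `β` in the
Morse graph of the associated path maps. -/
def Gamma (D : ∀ α β, V α →ₗ[R] V β) (M : Set (ι × ι)) (α β : ι) :
    V α →ₗ[R] V β :=
  ∑ᶠ p : MPath (MorseEdge R ι V D M) α β, pathMap R ι V D M p

end Morse2
/-- A path is either trivial or a first edge followed by a path. -/
def MPath.headEquiv {ι : Type v} (E : ι → ι → Prop) (α β : ι) :
    MPath E α β ≃ PLift (α = β) ⊕ Σ γ : {γ // E α γ}, MPath E γ.1 β where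
  toFun
    | .nil _ => .inl ⟨rfl⟩
    | .cons e p => .inr ⟨⟨_, e⟩, p⟩
  invFun
    | .inl ⟨h⟩ => h ▸ .nil α
    | .inr ⟨γ, p⟩ => .cons γ.2 p
  left_inv p := by cases p <;> rfl
  right_inv p := by
    rcases p with h | ⟨γ, p⟩
    · obtain ⟨rfl⟩ := h
      rfl
    · rfl

section MorsePaths

variable {R : Type u} [Ring R] {ι : Type v}
  {V : ι → Type w} [∀ α, AddCommGroup (V α)] [∀ α, Module R (V α)]
  {deg : ι → ℤ} {D : ∀ α β, V α →ₗ[R] V β} {M : Set (ι × ι)}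

theorem IsMorseMatching.source_unique (hM : IsMorseMatching R ι V deg D M) {α β γ : ι}
    (h : (β, α) ∈ M) (h' : (γ, α) ∈ M) : β = γ :=
  congrArg Prod.fst (hM.matching _ h _ h' (by simp))

theorem finite_mpath {α β : ι} (hE : {γ | MorseEdge R ι V D M α γ}.Finite)
    (hF : ∀ γ, MorseEdge R ι V D M α γ → Finite (MPath (MorseEdge R ι V D M) γ β)) :
    Finite (MPath (MorseEdge R ι V D M) α β) := by
  have : Finite {γ // MorseEdge R ι V D M α γ} := hE
  have (γ : {γ // MorseEdge R ι V D M α γ}) : Finite (MPath (MorseEdge R ι V D M) γ.1 β) :=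
    hF γ γ.2
  exact Finite.of_equiv _ (MPath.headEquiv _ α β).symm

theorem Gamma_eq_zero {α β : ι} (h : IsEmpty (MPath (MorseEdge R ι V D M) α β)) :
    Gamma R ι V D M α β = 0 :=
  finsum_of_isEmpty _

variable [DecidableEq ι]

theorem toLin_lof (hD : ∀ α, {β | D α β ≠ 0}.Finite) (α : ι) (s : Finset ι)
    (hs : ∀ β, D α β ≠ 0 → β ∈ s) (x : V α) :
    toLin R ι V D (lof R ι V α x) = ∑ β ∈ s, lof R ι V β (D α β x) := by
  rw [toLin, toModule_lof, dif_pos (hD α), LinearMap.sum_apply]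
  refine Finset.sum_subset (fun β hβ => hs β (by simpa using hβ)) fun β _ hβ => ?_
  have : D α β = 0 := by simpa using hβ
  simp [this]

theorem IsBasedComplex.deg_eq (hC : IsBasedComplex R ι V deg D) {α β : ι} (h : D α β ≠ 0) :
    deg β = deg α - 1 :=
  by_contra fun h' => h (hC.deg_cond α β h')

theorem IsMorseMatching.not_mem_of_mem (hC : IsBasedComplex R ι V deg D)
    (hM : IsMorseMatching R ι V deg D M) {α β γ : ι}
    (h : (β, α) ∈ M) : (γ, β) ∉ M := by
  intro h'
  have h1 := hM.matching _ h _ h' (by simp)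
  have h2 := hC.deg_eq (hM.edge _ h)
  simp only [Prod.mk.injEq] at h1 h2
  rw [h1.2] at h2
  lia

theorem finite_morseEdge (hC : IsBasedComplex R ι V deg D)
    (hM : IsMorseMatching R ι V deg D M) (α : ι) : {γ | MorseEdge R ι V D M α γ}.Finite := by
  have h : {γ | (γ, α) ∈ M}.Finite :=
    Set.Subsingleton.finite fun β hβ γ hγ => hM.source_unique hβ hγ
  refine ((hC.fin α).union h).subset ?_
  rintro γ (hγ | hγ)
  · exact .inl hγ.1
  · exact .inr hγ

/-- A path in the Morse graph raises the degree by at most one, and does so only if its source is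
the target of a matched edge. -/
theorem MPath.deg_le (hC : IsBasedComplex R ι V deg D) (hM : IsMorseMatching R ι V deg D M)
    {α β : ι} (p : MPath (MorseEdge R ι V D M) α β) :
    deg β ≤ deg α + 1 ∧ ((∀ γ, (γ, α) ∉ M) → deg β ≤ deg α) := by
  induction p with
  | nil α => exact ⟨by lia, fun _ => le_rfl⟩
  | @cons α γ β e p ih =>
    rcases e with e | e
    · have := hC.deg_eq e.1
      exact ⟨by lia, fun _ => by lia⟩
    · have h1 := hC.deg_eq (hM.edge _ e)
      have h2 := ih.2 fun _ => hM.not_mem_of_mem hC e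
      simp only at h1
      exact ⟨by lia, fun h => (h _ e).elim⟩

theorem Gamma_apply_eq_add_sum {α β : ι} (hE : {γ | MorseEdge R ι V D M α γ}.Finite)
    (hF : ∀ γ, MorseEdge R ι V D M α γ → Finite (MPath (MorseEdge R ι V D M) γ β)) (x : V α) :
    Gamma R ι V D M α β x = lof R ι V α x β +
      ∑ γ ∈ hE.toFinset, Gamma R ι V D M γ β (edgeMap R ι V D M α γ x) := by
  have : Finite {γ // MorseEdge R ι V D M α γ} := hE
  have (γ : {γ // MorseEdge R ι V D M α γ}) : Finite (MPath (MorseEdge R ι V D M) γ.1 β) :=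
    hF γ γ.2
  have := finite_mpath hE hF
  have := Fintype.ofFinite {γ // MorseEdge R ι V D M α γ}
  have (γ : {γ // MorseEdge R ι V D M α γ}) := Fintype.ofFinite (MPath (MorseEdge R ι V D M) γ.1 β)
  have := Fintype.ofFinite (MPath (MorseEdge R ι V D M) α β)
  rw [Gamma, finsum_eq_sum_of_fintype, LinearMap.sum_apply,
    ← (MPath.headEquiv _ α β).symm.sum_comp, Fintype.sum_sum_type, Fintype.sum_sigma]
  congr 1
  · by_cases h : α = β
    · subst h
      have : Unique (PLift (α = α)) := ⟨⟨⟨rfl⟩⟩, fun _ => rfl⟩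
      rw [Fintype.sum_unique]
      exact (lof_apply R α x).symm
    · have : IsEmpty (PLift (α = β)) := ⟨fun p => h p.down⟩
      rw [lof_eq_of, of_eq_of_ne _ _ _ (Ne.symm h)]
      simp
  · rw [Finset.sum_subtype (p := MorseEdge R ι V D M α)
      hE.toFinset (by simp) fun γ => Gamma R ι V D M γ β (edgeMap R ι V D M α γ x)]
    refine Finset.sum_congr rfl fun γ _ => ?_
    rw [Gamma, finsum_eq_sum_of_fintype, LinearMap.sum_apply]
    rfl

theorem isEmpty_mpath_of_not_mem (hC : IsBasedComplex R ι V deg D)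
    (hM : IsMorseMatching R ι V deg D M) {α β γ : ι} (hβ : deg β = deg α + 1)
    (e : MorseEdge R ι V D M α γ) (h : (γ, α) ∉ M) :
    IsEmpty (MPath (MorseEdge R ι V D M) γ β) := by
  refine ⟨fun p => ?_⟩
  have h1 := hC.deg_eq (e.resolve_right h).1
  have h2 := (p.deg_le hC hM).1
  lia

theorem hTilde_lof (hM : IsMorseMatching R ι V deg D M) {α τ : ι} (h : (τ, α) ∈ M) (x : V α) :
    hTilde R ι V D M (lof R ι V α x) = lof R ι V τ (edgeMap R ι V D M α τ x) := by
  have h1 : ∃ β, (β, α) ∈ M ∧ Function.Bijective (D β α) := ⟨τ, h, hM.iso _ h⟩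
  obtain rfl : h1.choose = τ := hM.source_unique h1.choose_spec.1 h
  rw [hTilde, toModule_lof, dif_pos h1, edgeMap, dif_pos h1.choose_spec]
  simp

theorem hTilde_lof_eq_zero {α : ι} (h : ∀ τ, (τ, α) ∉ M) (x : V α) :
    hTilde R ι V D M (lof R ι V α x) = 0 := by
  rw [hTilde, toModule_lof, dif_neg fun ⟨τ, h', _⟩ => h τ h', LinearMap.zero_apply]

theorem toLin_sub_dTilde_lof (hC : IsBasedComplex R ι V deg D)
    {τ : ι} (h : ∀ γ, (γ, τ) ∉ M) (hE : {γ | MorseEdge R ι V D M τ γ}.Finite) (y : V τ) :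
    (toLin R ι V D - dTilde R ι V D M) (lof R ι V τ y) =
      ∑ γ ∈ hE.toFinset, lof R ι V γ (edgeMap R ι V D M τ γ y) := by
  have hsub (α : ι) : {β | (if (α, β) ∈ M then D α β else 0) ≠ 0} ⊆ {β | D α β ≠ 0} := by
    intro β hβ
    by_cases h : (α, β) ∈ M
    · simpa [h] using hβ
    · simp [h] at hβ
  rw [LinearMap.sub_apply, dTilde,
    toLin_lof hC.fin τ (hC.fin τ).toFinset (by simp),
    toLin_lof (fun α => (hC.fin α).subset (hsub α)) τ (hC.fin τ).toFinset
      (fun β hβ => by simpa using hsub τ hβ), ← Finset.sum_sub_distrib]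
  symm
  refine Finset.sum_subset_zero_on_sdiff ?_ ?_ ?_
  · intro γ hγ
    have := Or.resolve_right (hE.mem_toFinset.1 hγ) (h γ)
    simpa using this.1
  · intro γ hγ
    simp only [Finset.mem_sdiff, Set.Finite.mem_toFinset, Set.mem_ofPred_eq, MorseEdge, not_or,
      not_and, not_not] at hγ
    simp [hγ.2.1 hγ.1]
  · intro γ hγ
    have := Or.resolve_right (hE.mem_toFinset.1 hγ) (h γ)
    simp [this.2, edgeMap, h γ]

/-- The partial sums of the perturbation series are eventually constant, with components the
sums over paths. -/
theorem eventually_sum_hTilde_apply (hC : IsBasedComplex R ι V deg D)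
    (hM : IsMorseMatching R ι V deg D M) {t : (⨁ α, V α) →ₗ[R] ⨁ α, V α}
    (ht : t = toLin R ι V D - dTilde R ι V D M) (α : ι) :
    (∀ β, deg β = deg α + 1 → Finite (MPath (MorseEdge R ι V D M) α β)) ∧
    ∀ᶠ n : ℕ in Filter.atTop, ∀ x : V α,
      ((hTilde R ι V D M ∘ₗ t) ^ n) (hTilde R ι V D M (lof R ι V α x)) = 0 ∧
      ∀ β, (∑ i ∈ Finset.range n,
        ((hTilde R ι V D M ∘ₗ t) ^ i) (hTilde R ι V D M (lof R ι V α x))) β =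
          if deg β = deg α + 1 then Gamma R ι V D M α β x else 0 := by
  obtain ⟨r, hr, -, hr'⟩ := hM.wf
  induction α using hr.induction with
  | _ α ih =>
  have hE := finite_morseEdge hC hM
  by_cases hα : ∃ τ, (τ, α) ∈ M
  · obtain ⟨τ, hτ⟩ := hα
    have hdeg : deg α = deg τ - 1 := hC.deg_eq (hM.edge _ hτ)
    have hτM (γ : ι) : (γ, τ) ∉ M := hM.not_mem_of_mem hC hτ
    have hγdeg {γ : ι} (e : MorseEdge R ι V D M τ γ) : deg γ = deg α := by
      rw [hdeg, hC.deg_eq (e.resolve_right (hτM γ)).1]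
    have ih' {γ : ι} (e : MorseEdge R ι V D M τ γ) :=
      ih γ (hr' α τ γ (hγdeg e) (.inr hτ) e)
    have hfinτ {β : ι} (hβ : deg β = deg α + 1) {γ : ι} (e : MorseEdge R ι V D M τ γ) :
        Finite (MPath (MorseEdge R ι V D M) γ β) :=
      (ih' e).1 β (by rw [hβ, hγdeg e])
    have hfin {β : ι} (hβ : deg β = deg α + 1) {γ : ι} (e : MorseEdge R ι V D M α γ) :
        Finite (MPath (MorseEdge R ι V D M) γ β) := by
      by_cases h : (γ, α) ∈ M
      · obtain rfl := hM.source_unique h hτ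
        exact finite_mpath (hE γ) fun _ => hfinτ hβ
      · have := isEmpty_mpath_of_not_mem hC hM hβ e h
        infer_instance
    refine ⟨fun β hβ => finite_mpath (hE α) fun _ => hfin hβ, ?_⟩
    have hev := (Filter.eventually_all_finset (hE τ).toFinset).2 fun γ hγ =>
      (ih' ((hE τ).mem_toFinset.1 hγ)).2
    rw [← Filter.map_add_atTop_eq_nat 1, Filter.eventually_map]
    filter_upwards [hev] with n hn x
    have hstep (i : ℕ) : ((hTilde R ι V D M ∘ₗ t) ^ (i + 1)) (hTilde R ι V D M (lof R ι V α x)) =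
        ∑ γ ∈ (hE τ).toFinset, ((hTilde R ι V D M ∘ₗ t) ^ i) (hTilde R ι V D M
          (lof R ι V γ (edgeMap R ι V D M τ γ (edgeMap R ι V D M α τ x)))) := by
      rw [pow_succ, Module.End.mul_apply, hTilde_lof hM hτ, LinearMap.comp_apply, ht,
        toLin_sub_dTilde_lof hC hτM (hE τ), map_sum, map_sum]
    refine ⟨?_, fun β => ?_⟩
    · rw [hstep]
      exact Finset.sum_eq_zero fun γ hγ => (hn γ hγ _).1
    · rw [Finset.sum_range_succ']
      simp_rw [hstep]
      rw [Finset.sum_comm, pow_zero, Module.End.one_apply, hTilde_lof hM hτ, DirectSum.add_apply,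
        DFinsupp.finsetSum_apply, Finset.sum_congr rfl fun γ hγ => (hn γ hγ _).2 β]
      by_cases hβ : deg β = deg α + 1
      · rw [if_pos hβ, Gamma_apply_eq_add_sum (hE α) fun _ => hfin hβ,
          Finset.sum_eq_single_of_mem τ ((hE α).mem_toFinset.2 (.inr hτ)),
          Gamma_apply_eq_add_sum (hE τ) fun _ => hfinτ hβ, lof_eq_of R ι V α,
          of_eq_of_ne _ _ _ (by rintro rfl; lia), zero_add, add_comm]
        · congr 1
          refine Finset.sum_congr rfl fun γ hγ => ?_
          rw [if_pos (by rw [hβ, hγdeg ((hE τ).mem_toFinset.1 hγ)])]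
        · intro γ hγ hne
          rw [Gamma_eq_zero (isEmpty_mpath_of_not_mem hC hM hβ ((hE α).mem_toFinset.1 hγ)
            fun h => hne (hM.source_unique h hτ)), LinearMap.zero_apply]
      · rw [if_neg hβ, lof_eq_of, of_eq_of_ne _ _ _ (by rintro rfl; lia), add_zero]
        refine Finset.sum_eq_zero fun γ hγ => ?_
        rw [if_neg (by rwa [hγdeg ((hE τ).mem_toFinset.1 hγ)])]
  · push Not at hα
    have hemp {β : ι} (hβ : deg β = deg α + 1) : IsEmpty (MPath (MorseEdge R ι V D M) α β) :=
      ⟨fun p => by have := (p.deg_le hC hM).2 hα; lia⟩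
    refine ⟨fun β hβ => ?_, .of_forall fun n x => ⟨?_, fun β => ?_⟩⟩
    · have := hemp hβ
      infer_instance
    · rw [hTilde_lof_eq_zero hα, map_zero]
    · simp_rw [hTilde_lof_eq_zero hα, map_zero, Finset.sum_const_zero]
      split_ifs with hβ
      · rw [Gamma_eq_zero (hemp hβ)]
        rfl
      · rfl

theorem finsum_lof_apply (z : ⨁ α, V α) : ∑ᶠ β, lof R ι V β (z β) = z := by
  rw [finsum_eq_sum_of_support_subset (s := DFinsupp.support z)]
  · exact DirectSum.sum_support_of z
  · intro β hβ
    simp only [Finset.mem_coe, DFinsupp.mem_support_toFun]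
    intro h
    simp [h] at hβ

end MorsePaths

theorem perturbed_homotopy_closed_form
    (R : Type u) [Ring R] (ι : Type v) [DecidableEq ι]
    (V : ι → Type w) [∀ α, AddCommGroup (V α)] [∀ α, Module R (V α)]
    (deg : ι → ℤ) (D : ∀ α β, V α →ₗ[R] V β) (M : Set (ι × ι))
    (hC : IsBasedComplex R ι V deg D) (hM : IsMorseMatching R ι V deg D M)
    (t : (⨁ α, V α) →ₗ[R] ⨁ α, V α)
    (ht : t = toLin R ι V D - dTilde R ι V D M)
    (α : ι) (x : V α) :
    ∑ᶠ i : ℕ, ((hTilde R ι V D M ∘ₗ t) ^ i)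
        (hTilde R ι V D M (DirectSum.lof R ι V α x)) =
      ∑ᶠ β ∈ {β : ι | deg β = deg α + 1},
        DirectSum.lof R ι V β (Gamma R ι V D M α β x) := by
  obtain ⟨n, hn⟩ := Filter.eventually_atTop.1 (eventually_sum_hTilde_apply hC hM ht α).2
  rw [finsum_eq_sum_of_support_subset (s := Finset.range n)]
  · rw [← finsum_lof_apply (R := R) (∑ i ∈ Finset.range n,
      ((hTilde R ι V D M ∘ₗ t) ^ i) (hTilde R ι V D M (lof R ι V α x)))]
    refine finsum_congr fun β => ?_
    rw [(hn n le_rfl x).2 β]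
    by_cases hβ : deg β = deg α + 1 <;> simp [hβ]
  · intro i hi
    rw [Finset.mem_coe, Finset.mem_range]
    by_contra h
    exact hi (hn i (not_lt.1 h) x).1
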